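/- For m ≥ 0, any solution (u, W) of the radial ODE system u'' + u'/r − (m^2/r^2)u = (W−1)u, W'' + W'/r = u^2 on (0,∞) with W(0) = W'(0) = 0, u > 0 on (0,∞), and u(r) → 0 as r → ∞ (and r w(r) → 0 as r → ∞ where w = u_2'u_1 − u_1'u_2 for two such solutions), is unique. -/

import Mathlib

open Filter

section Calculus

theorem nonneg_of_hasDerivAt_of_tendsto_zero {a r : ℝ} (har : a < r) {f f' : ℝ → ℝ}
    (hf : ∀ x ∈ Set.Ioc a r, HasDerivAt f (f' x) x)
    (hlim : Tendsto f (nhdsWithin a (Set.Ioi a)) (nhds 0))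
    (hf' : ∀ x ∈ Set.Ioc a r, 0 ≤ f' x) : 0 ≤ f r := by
  have hmono : MonotoneOn f (Set.Ioc a r) := by
    refine monotoneOn_of_deriv_nonneg (convex_Ioc a r)
      (fun x hx => (hf x hx).continuousAt.continuousWithinAt) ?_ ?_
    · intro x hx
      exact (hf x (interior_subset hx)).differentiableAt.differentiableWithinAt
    · intro x hx
      rw [(hf x (interior_subset hx)).deriv]
      exact hf' x (interior_subset hx)
  refine le_of_tendsto hlim ?_
  filter_upwards [Ioc_mem_nhdsGT har] with x hx
  exact hmono hx ⟨har, le_rfl⟩ hx.2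

theorem strictMonoOn_Ioc_of_hasDerivAt_pos {a r : ℝ} {f f' : ℝ → ℝ}
    (hf : ∀ x ∈ Set.Ioc a r, HasDerivAt f (f' x) x)
    (hf' : ∀ x ∈ Set.Ioo a r, 0 < f' x) : StrictMonoOn f (Set.Ioc a r) := by
  refine strictMonoOn_of_deriv_pos (convex_Ioc a r)
    (fun x hx => (hf x hx).continuousAt.continuousWithinAt) ?_
  intro x hx
  rw [interior_Ioc] at hx
  rw [(hf x ⟨hx.1, hx.2.le⟩).deriv]
  exact hf' x hx

theorem pos_of_hasDerivAt_of_tendsto_zero {a r : ℝ} (har : a < r) {f f' : ℝ → ℝ}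
    (hf : ∀ x ∈ Set.Ioc a r, HasDerivAt f (f' x) x)
    (hlim : Tendsto f (nhdsWithin a (Set.Ioi a)) (nhds 0))
    (hf' : ∀ x ∈ Set.Ioo a r, 0 < f' x) : 0 < f r := by
  have hc : a < (a + r) / 2 := by linarith
  have hcr : (a + r) / 2 < r := by linarith
  have h₀ : 0 ≤ f ((a + r) / 2) :=
    nonneg_of_hasDerivAt_of_tendsto_zero hc (fun x hx => hf x ⟨hx.1, hx.2.trans hcr.le⟩) hlim
      (fun x hx => (hf' x ⟨hx.1, hx.2.trans_lt hcr⟩).le)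
  exact h₀.trans_lt (strictMonoOn_Ioc_of_hasDerivAt_pos hf hf' ⟨hc, hcr.le⟩ ⟨har, le_rfl⟩ hcr)

theorem abs_le_of_hasDerivAt_of_tendsto_zero {a r K : ℝ} (har : a < r) {f f' : ℝ → ℝ}
    (hf : ∀ x ∈ Set.Ioc a r, HasDerivAt f (f' x) x)
    (hlim : Tendsto f (nhdsWithin a (Set.Ioi a)) (nhds 0))
    (hf' : ∀ x ∈ Set.Ioc a r, |f' x| ≤ K) : |f r| ≤ K * (r - a) := by
  have hlin : Tendsto (fun x => K * (x - a)) (nhdsWithin a (Set.Ioi a)) (nhds 0) := by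
    have : Continuous fun x : ℝ => K * (x - a) := by fun_prop
    simpa using (this.tendsto a).mono_left nhdsWithin_le_nhds
  have hder : ∀ x, HasDerivAt (fun x => K * (x - a)) K x := fun x => by
    simpa using ((hasDerivAt_id x).sub_const a).const_mul K
  have h₁ := nonneg_of_hasDerivAt_of_tendsto_zero har
    (fun x hx => (hder x).sub (hf x hx)) (by simpa only [sub_zero] using! hlin.sub hlim)
    (fun x hx => sub_nonneg.2 (abs_le.1 (hf' x hx)).2)
  have h₂ := nonneg_of_hasDerivAt_of_tendsto_zero har
    (fun x hx => (hder x).add (hf x hx)) (by simpa only [add_zero] using! hlin.add hlim)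
    (fun x hx => by linarith [(abs_le.1 (hf' x hx)).1])
  simp only [Pi.sub_apply, Pi.add_apply] at h₁ h₂
  exact abs_le.2 ⟨by linarith, by linarith⟩

theorem hasDerivAt_deriv_of_contDiffOn {f : ℝ → ℝ} (hf : ContDiffOn ℝ 2 f (Set.Ici 0))
    {r : ℝ} (hr : 0 < r) : HasDerivAt f (deriv f r) r :=
  ((hf.contDiffAt (Ici_mem_nhds hr)).differentiableAt (by norm_num)).hasDerivAt

theorem hasDerivAt_deriv_deriv_of_contDiffOn {f : ℝ → ℝ} (hf : ContDiffOn ℝ 2 f (Set.Ici 0))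
    {r : ℝ} (hr : 0 < r) : HasDerivAt (deriv f) (deriv (deriv f) r) r := by
  have h : ContDiffOn ℝ 1 (deriv f) (Set.Ioi 0) :=
    (hf.mono Set.Ioi_subset_Ici_self).deriv_of_isOpen isOpen_Ioi (by norm_num)
  exact ((h.contDiffAt (Ioi_mem_nhds hr)).differentiableAt (by norm_num)).hasDerivAt

theorem tendsto_mul_deriv_nhdsGT_zero {f : ℝ → ℝ} (hf : ContDiffOn ℝ 2 f (Set.Ici 0)) :
    Tendsto (fun r => r * deriv f r) (nhdsWithin 0 (Set.Ioi 0)) (nhds 0) := by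
  have hc : ContinuousOn (derivWithin f (Set.Ici 0)) (Set.Ici 0) :=
    hf.continuousOn_derivWithin (uniqueDiffOn_Ici 0) (by norm_num)
  have h₁ : Tendsto (derivWithin f (Set.Ici 0)) (nhdsWithin 0 (Set.Ioi 0))
      (nhds (derivWithin f (Set.Ici 0) 0)) :=
    (hc 0 Set.self_mem_Ici).mono_left (nhdsWithin_mono _ Set.Ioi_subset_Ici_self)
  have h₂ : Tendsto (fun r : ℝ => r) (nhdsWithin 0 (Set.Ioi 0)) (nhds 0) :=
    tendsto_id.mono_left nhdsWithin_le_nhds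
  have h₃ := h₂.mul h₁
  rw [zero_mul] at h₃
  refine h₃.congr' ?_
  filter_upwards [self_mem_nhdsWithin] with r hr
  rw [derivWithin_of_mem_nhds (Ici_mem_nhds hr)]

theorem exists_le_two_mul_of_tendsto_pos {f : ℝ → ℝ} {a c : ℝ} (hc : 0 < c)
    (h : Tendsto f (nhdsWithin a (Set.Ioi a)) (nhds c)) :
    ∃ b > a, ∀ s r, a < s → s ≤ r → r ≤ b → f s ≤ 2 * f r := by
  have h₁ : ∀ᶠ x in nhdsWithin a (Set.Ioi a), 2 / 3 * c < f x ∧ f x < 4 / 3 * c :=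
    (h.eventually_const_lt (by linarith)).and (h.eventually_lt_const (by linarith))
  obtain ⟨b, hb, hsub⟩ := (mem_nhdsGT_iff_exists_Ioc_subset).1 h₁
  refine ⟨b, hb, fun s r has hsr hrb => ?_⟩
  have hs := (hsub (show s ∈ Set.Ioc a b from ⟨has, hsr.trans hrb⟩)).2
  have hr := (hsub (show r ∈ Set.Ioc a b from ⟨has.trans_le hsr, hrb⟩)).1
  linarith

end Calculus

/-- A positive `C²` solution of the radial system on the half-line, with `W 0 = 0`. -/
structure IsRadialSolution (m : ℝ) (u W : ℝ → ℝ) : Prop where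
  contDiffOn_u : ContDiffOn ℝ 2 u (Set.Ici 0)
  contDiffOn_W : ContDiffOn ℝ 2 W (Set.Ici 0)
  ode_u : ∀ r > (0 : ℝ),
    deriv (deriv u) r + deriv u r / r - m ^ 2 / r ^ 2 * u r = (W r - 1) * u r
  ode_W : ∀ r > (0 : ℝ), deriv (deriv W) r + deriv W r / r = u r ^ 2
  W_zero : W 0 = 0
  pos : ∀ r > (0 : ℝ), 0 < u r

/-- The Wronskian of `u₁` and `u₂`, weighted by `r`. -/
noncomputable def radialWronskian (u₁ u₂ : ℝ → ℝ) (r : ℝ) : ℝ :=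
  r * (deriv u₂ r * u₁ r - deriv u₁ r * u₂ r)

/-- The difference of the derivatives of `W₂` and `W₁`, weighted by `r`. -/
noncomputable def radialFlux (W₁ W₂ : ℝ → ℝ) (r : ℝ) : ℝ :=
  r * (deriv W₂ r - deriv W₁ r)

/-- The logarithm of `u₂ / u₁`, for positive functions. -/
noncomputable def logRatio (u₁ u₂ : ℝ → ℝ) (r : ℝ) : ℝ :=
  Real.log (u₂ r) - Real.log (u₁ r)

namespace IsRadialSolution

variable {m : ℝ} {u W u₁ W₁ u₂ W₂ : ℝ → ℝ}

theorem tendsto_u (h : IsRadialSolution m u W) {a : ℝ} (ha : 0 ≤ a) :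
    Tendsto u (nhdsWithin a (Set.Ioi a)) (nhds (u a)) :=
  (h.contDiffOn_u.continuousOn a ha).mono_left
    (nhdsWithin_mono _ fun _ hx => ha.trans (le_of_lt hx))

theorem tendsto_W (h : IsRadialSolution m u W) {a : ℝ} (ha : 0 ≤ a) :
    Tendsto W (nhdsWithin a (Set.Ioi a)) (nhds (W a)) :=
  (h.contDiffOn_W.continuousOn a ha).mono_left
    (nhdsWithin_mono _ fun _ hx => ha.trans (le_of_lt hx))

theorem hasDerivAt_mul_deriv (h : IsRadialSolution m u W) {r : ℝ} (hr : 0 < r) :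
    HasDerivAt (fun r => r * deriv u r) ((r ^ 2 * (W r - 1) + m ^ 2) * u r / r) r := by
  have h₁ := (hasDerivAt_id r).mul (hasDerivAt_deriv_deriv_of_contDiffOn h.contDiffOn_u hr)
  refine h₁.congr_deriv ?_
  have h₂ := h.ode_u r hr
  have h₃ : deriv (deriv u) r = (W r - 1) * u r + m ^ 2 / r ^ 2 * u r - deriv u r / r := by
    linarith
  rw [h₃]
  simp only [id]
  field_simp
  ring

theorem hasDerivAt_mul_deriv_W (h : IsRadialSolution m u W) {r : ℝ} (hr : 0 < r) :
    HasDerivAt (fun r => r * deriv W r) (r * u r ^ 2) r := by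
  have h₁ := (hasDerivAt_id r).mul (hasDerivAt_deriv_deriv_of_contDiffOn h.contDiffOn_W hr)
  refine h₁.congr_deriv ?_
  rw [← h.ode_W r hr]
  simp only [id]
  field_simp
  ring

theorem hasDerivAt_radialFlux (h₁ : IsRadialSolution m u₁ W₁) (h₂ : IsRadialSolution m u₂ W₂)
    {r : ℝ} (hr : 0 < r) :
    HasDerivAt (radialFlux W₁ W₂) (r * (u₂ r ^ 2 - u₁ r ^ 2)) r := by
  have h := (h₂.hasDerivAt_mul_deriv_W hr).sub (h₁.hasDerivAt_mul_deriv_W hr)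
  convert! h using 1
  · ext x
    simp only [radialFlux, Pi.sub_apply]
    ring
  · ring

theorem hasDerivAt_W_sub (h₁ : IsRadialSolution m u₁ W₁) (h₂ : IsRadialSolution m u₂ W₂)
    {r : ℝ} (hr : 0 < r) :
    HasDerivAt (fun r => W₂ r - W₁ r) (radialFlux W₁ W₂ r / r) r := by
  refine ((hasDerivAt_deriv_of_contDiffOn h₂.contDiffOn_W hr).sub
    (hasDerivAt_deriv_of_contDiffOn h₁.contDiffOn_W hr)).congr_deriv ?_
  rw [radialFlux, mul_div_cancel_left₀ _ hr.ne']

theorem hasDerivAt_radialWronskian (h₁ : IsRadialSolution m u₁ W₁)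
    (h₂ : IsRadialSolution m u₂ W₂) {r : ℝ} (hr : 0 < r) :
    HasDerivAt (radialWronskian u₁ u₂) (r * (W₂ r - W₁ r) * (u₁ r * u₂ r)) r := by
  have h := ((h₂.hasDerivAt_mul_deriv hr).mul
      (hasDerivAt_deriv_of_contDiffOn h₁.contDiffOn_u hr)).sub
    ((h₁.hasDerivAt_mul_deriv hr).mul (hasDerivAt_deriv_of_contDiffOn h₂.contDiffOn_u hr))
  convert! h using 1
  · ext x
    simp only [radialWronskian, Pi.sub_apply, Pi.mul_apply]
    ring
  · field_simp
    ring

theorem hasDerivAt_logRatio (h₁ : IsRadialSolution m u₁ W₁) (h₂ : IsRadialSolution m u₂ W₂)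
    {r : ℝ} (hr : 0 < r) :
    HasDerivAt (logRatio u₁ u₂) (radialWronskian u₁ u₂ r / (r * (u₁ r * u₂ r))) r := by
  have p₁ := h₁.pos r hr
  have p₂ := h₂.pos r hr
  refine (((hasDerivAt_deriv_of_contDiffOn h₂.contDiffOn_u hr).log p₂.ne').sub
    ((hasDerivAt_deriv_of_contDiffOn h₁.contDiffOn_u hr).log p₁.ne')).congr_deriv ?_
  rw [radialWronskian]
  field_simp

theorem tendsto_W_sub_zero (h₁ : IsRadialSolution m u₁ W₁) (h₂ : IsRadialSolution m u₂ W₂) :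
    Tendsto (fun r => W₂ r - W₁ r) (nhdsWithin 0 (Set.Ioi 0)) (nhds 0) := by
  simpa [h₁.W_zero, h₂.W_zero] using (h₂.tendsto_W le_rfl).sub (h₁.tendsto_W le_rfl)

theorem tendsto_radialFlux_zero (h₁ : IsRadialSolution m u₁ W₁)
    (h₂ : IsRadialSolution m u₂ W₂) :
    Tendsto (radialFlux W₁ W₂) (nhdsWithin 0 (Set.Ioi 0)) (nhds 0) := by
  have h := (tendsto_mul_deriv_nhdsGT_zero h₂.contDiffOn_W).sub
    (tendsto_mul_deriv_nhdsGT_zero h₁.contDiffOn_W)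
  rw [sub_zero] at h
  refine h.congr fun r => ?_
  rw [radialFlux]
  ring

theorem tendsto_radialWronskian_zero (h₁ : IsRadialSolution m u₁ W₁)
    (h₂ : IsRadialSolution m u₂ W₂) :
    Tendsto (radialWronskian u₁ u₂) (nhdsWithin 0 (Set.Ioi 0)) (nhds 0) := by
  have h := ((tendsto_mul_deriv_nhdsGT_zero h₂.contDiffOn_u).mul (h₁.tendsto_u le_rfl)).sub
    ((tendsto_mul_deriv_nhdsGT_zero h₁.contDiffOn_u).mul (h₂.tendsto_u le_rfl))
  rw [zero_mul, zero_mul, sub_zero] at h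
  refine h.congr fun r => ?_
  rw [radialWronskian]
  ring

theorem exists_le_two_mul_zero (h : IsRadialSolution m u W) :
    ∃ b > 0, ∀ s r, 0 < s → s ≤ r → r ≤ b → u s ≤ 2 * u r := by
  have hW : Tendsto (fun r => W r) (nhdsWithin 0 (Set.Ioi 0)) (nhds 0) := by
    simpa [h.W_zero] using h.tendsto_W le_rfl
  have hid : Tendsto (fun r : ℝ => r) (nhdsWithin 0 (Set.Ioi 0)) (nhds 0) :=
    tendsto_id.mono_left nhdsWithin_le_nhds
  have hu' := tendsto_mul_deriv_nhdsGT_zero h.contDiffOn_u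
  rcases eq_or_ne m 0 with rfl | hm
  · refine exists_le_two_mul_of_tendsto_pos ?_ (h.tendsto_u le_rfl)
    obtain ⟨b, hb, hsub⟩ := (mem_nhdsGT_iff_exists_Ioc_subset).1
      (hW.eventually_lt_const (show (0 : ℝ) < 1 by norm_num))
    have hder : ∀ r ∈ Set.Ioc 0 b, 0 < -deriv u r := by
      intro r hr
      have hpos := pos_of_hasDerivAt_of_tendsto_zero hr.1
        (fun x hx => (h.hasDerivAt_mul_deriv hx.1).neg)
        (by simpa only [neg_zero] using! hu'.neg) (fun x hx => by
          have hWx : W x < 1 := hsub ⟨hx.1, hx.2.le.trans hr.2⟩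
          have hx0 := hx.1
          have := h.pos x hx.1
          have h1 : 0 < 1 - W x := by linarith
          have : 0 < (x ^ 2 * (1 - W x)) * u x / x := by positivity
          convert this using 1
          ring)
      simp only [Pi.neg_apply] at hpos
      rw [← mul_neg] at hpos
      exact pos_of_mul_pos_right hpos hr.1.le
    have hpos := pos_of_hasDerivAt_of_tendsto_zero (f := fun x => u 0 - u x) hb
      (fun x hx => (hasDerivAt_deriv_of_contDiffOn h.contDiffOn_u hx.1).const_sub (u 0))
      (by simpa using (h.tendsto_u le_rfl).const_sub (u 0))
      (fun x hx => hder x ⟨hx.1, hx.2.le⟩)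
    have := h.pos b hb
    linarith
  · have hlim : Tendsto (fun r => r ^ 2 * (W r - 1) + m ^ 2) (nhdsWithin 0 (Set.Ioi 0))
        (nhds (m ^ 2)) := by
      simpa using ((hid.pow 2).mul (hW.sub_const 1)).add_const (m ^ 2)
    obtain ⟨b, hb, hsub⟩ := (mem_nhdsGT_iff_exists_Ioc_subset).1
      (hlim.eventually_const_lt (show 0 < m ^ 2 by positivity))
    have hder : ∀ r ∈ Set.Ioc 0 b, 0 < deriv u r := by
      intro r hr
      have hpos := pos_of_hasDerivAt_of_tendsto_zero hr.1
        (fun x hx => h.hasDerivAt_mul_deriv hx.1) hu' (fun x hx =>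
          div_pos (mul_pos (hsub ⟨hx.1, hx.2.le.trans hr.2⟩) (h.pos x hx.1)) hx.1)
      exact pos_of_mul_pos_right hpos hr.1.le
    have hmono := strictMonoOn_Ioc_of_hasDerivAt_pos
      (fun x hx => hasDerivAt_deriv_of_contDiffOn h.contDiffOn_u hx.1)
      (fun x hx => hder x ⟨hx.1, hx.2.le⟩)
    refine ⟨b, hb, fun s r hs hsr hrb => ?_⟩
    have h₁ := hmono.monotoneOn ⟨hs, hsr.trans hrb⟩ ⟨hs.trans_le hsr, hrb⟩ hsr
    linarith [h.pos r (hs.trans_le hsr)]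

theorem exists_le_two_mul (h : IsRadialSolution m u W) {a : ℝ} (ha : 0 ≤ a) :
    ∃ b > a, ∀ s r, a < s → s ≤ r → r ≤ b → u s ≤ 2 * u r := by
  rcases ha.eq_or_lt with rfl | ha'
  · exact h.exists_le_two_mul_zero
  · exact exists_le_two_mul_of_tendsto_pos (h.pos a ha') (h.tendsto_u ha)

theorem abs_deriv_logRatio_le (h₁ : IsRadialSolution m u₁ W₁) (h₂ : IsRadialSolution m u₂ W₂)
    {a b N : ℝ} (ha : 0 ≤ a)
    (hu₁ : ∀ s r, a < s → s ≤ r → r ≤ b → u₁ s ≤ 2 * u₁ r)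
    (hu₂ : ∀ s r, a < s → s ≤ r → r ≤ b → u₂ s ≤ 2 * u₂ r)
    (hN : ∀ r ∈ Set.Ioc a b, |W₂ r - W₁ r| ≤ N)
    (hlim : Tendsto (radialWronskian u₁ u₂) (nhdsWithin a (Set.Ioi a)) (nhds 0))
    {r : ℝ} (hr : r ∈ Set.Ioc a b) :
    |radialWronskian u₁ u₂ r / (r * (u₁ r * u₂ r))| ≤ 4 * N * (b - a) := by
  have hr0 : 0 < r := ha.trans_lt hr.1
  have p₁ := h₁.pos r hr0
  have p₂ := h₂.pos r hr0
  have hN0 : 0 ≤ N := (abs_nonneg _).trans (hN r hr)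
  have hw := abs_le_of_hasDerivAt_of_tendsto_zero (K := r * N * (2 * u₁ r * (2 * u₂ r))) hr.1
    (fun x hx => h₁.hasDerivAt_radialWronskian h₂ (ha.trans_lt hx.1)) hlim (by
      intro x hx
      have hx0 : 0 < x := ha.trans_lt hx.1
      have q₁ := h₁.pos x hx0
      have q₂ := h₂.pos x hx0
      rw [abs_mul, abs_mul, abs_of_pos hx0, abs_of_pos (mul_pos q₁ q₂)]
      have e₁ := hu₁ x r hx.1 hx.2 hr.2
      have e₂ := hu₂ x r hx.1 hx.2 hr.2
      have e₃ := hN x ⟨hx.1, hx.2.trans hr.2⟩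
      have e₄ := hx.2
      gcongr)
  rw [abs_div, abs_of_pos (by positivity : 0 < r * (u₁ r * u₂ r)), div_le_iff₀ (by positivity)]
  calc _ ≤ _ := hw
    _ = 4 * N * (r - a) * (r * (u₁ r * u₂ r)) := by ring
    _ ≤ _ := by
      have := hr.2
      gcongr

theorem abs_u_sq_sub_le (h₁ : IsRadialSolution m u₁ W₁) (h₂ : IsRadialSolution m u₂ W₂)
    {r B : ℝ} (hr : 0 < r) (hB₁ : u₁ r ≤ B) (hB₂ : u₂ r ≤ B) :
    |u₂ r ^ 2 - u₁ r ^ 2| ≤ 2 * B ^ 2 * |logRatio u₁ u₂ r| := by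
  have key : ∀ x y : ℝ, 0 < x → 0 < y → y ≤ B →
      y - x ≤ B * |Real.log y - Real.log x| := by
    intro x y hx hy hyB
    have h := Real.one_sub_inv_le_log_of_pos (div_pos hy hx)
    rw [Real.log_div hy.ne' hx.ne', inv_div] at h
    have h' : y - x ≤ y * (Real.log y - Real.log x) := by
      calc y - x = y * (1 - x / y) := by field_simp
        _ ≤ _ := by gcongr
    exact h'.trans ((mul_le_mul_of_nonneg_left (le_abs_self _) hy.le).trans
      (mul_le_mul_of_nonneg_right hyB (abs_nonneg _)))
  have p₁ := h₁.pos r hr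
  have p₂ := h₂.pos r hr
  have hsub : |u₂ r - u₁ r| ≤ B * |logRatio u₁ u₂ r| := by
    rw [abs_le']
    refine ⟨key _ _ p₁ p₂ hB₂, ?_⟩
    have := key _ _ p₂ p₁ hB₁
    rw [abs_sub_comm] at this
    simpa [logRatio] using this
  calc |u₂ r ^ 2 - u₁ r ^ 2| = |u₂ r - u₁ r| * (u₂ r + u₁ r) := by
        rw [sq_sub_sq, abs_mul, abs_of_pos (add_pos p₂ p₁), mul_comm]
    _ ≤ (B * |logRatio u₁ u₂ r|) * (B + B) := by
        have : 0 ≤ B := p₁.le.trans hB₁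
        gcongr
    _ = _ := by ring

theorem abs_W_sub_le (h₁ : IsRadialSolution m u₁ W₁) (h₂ : IsRadialSolution m u₂ W₂)
    {a b K : ℝ} (ha : 0 ≤ a)
    (hK : ∀ r ∈ Set.Ioc a b, |u₂ r ^ 2 - u₁ r ^ 2| ≤ K)
    (hflux : Tendsto (radialFlux W₁ W₂) (nhdsWithin a (Set.Ioi a)) (nhds 0))
    (hW : Tendsto (fun r => W₂ r - W₁ r) (nhdsWithin a (Set.Ioi a)) (nhds 0))
    {r : ℝ} (hr : r ∈ Set.Ioc a b) : |W₂ r - W₁ r| ≤ K * (b - a) ^ 2 := by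
  have hK0 : 0 ≤ K := (abs_nonneg _).trans (hK r hr)
  have hrb := hr.2
  have hra := hr.1
  have h := abs_le_of_hasDerivAt_of_tendsto_zero (K := K * (b - a)) hr.1
    (fun x hx => h₁.hasDerivAt_W_sub h₂ (ha.trans_lt hx.1)) hW (by
      intro x hx
      have hx0 : 0 < x := ha.trans_lt hx.1
      have hxb : x ≤ b := hx.2.trans hr.2
      have hfl := abs_le_of_hasDerivAt_of_tendsto_zero (K := x * K) hx.1
        (fun y hy => h₁.hasDerivAt_radialFlux h₂ (ha.trans_lt hy.1)) hflux (by
          intro y hy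
          have hy0 : 0 < y := ha.trans_lt hy.1
          have hyx := hy.2
          have := hK y ⟨hy.1, hy.2.trans hxb⟩
          rw [abs_mul, abs_of_pos hy0]
          gcongr)
      rw [abs_div, abs_of_pos hx0, div_le_iff₀ hx0]
      calc _ ≤ _ := hfl
        _ = K * (x - a) * x := by ring
        _ ≤ _ := by gcongr)
  calc _ ≤ _ := h
    _ ≤ K * (b - a) * (b - a) := by
      have : 0 ≤ b - a := by linarith
      gcongr
    _ = _ := by ring

theorem W_eq_of_u_eq (h₁ : IsRadialSolution m u₁ W₁) (h₂ : IsRadialSolution m u₂ W₂)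
    {a : ℝ} (h : ∀ r ∈ Set.Ioc 0 a, u₁ r = u₂ r) {r : ℝ} (hr : r ∈ Set.Ioc 0 a) :
    W₂ r - W₁ r = 0 := by
  have := h₁.abs_W_sub_le h₂ (K := 0) le_rfl (fun x hx => by simp [h x hx])
    (h₁.tendsto_radialFlux_zero h₂) (h₁.tendsto_W_sub_zero h₂) hr
  simpa using this

theorem tendsto_of_u_eq (h₁ : IsRadialSolution m u₁ W₁) (h₂ : IsRadialSolution m u₂ W₂)
    {a : ℝ} (ha : 0 ≤ a) (h : ∀ r ∈ Set.Ioc 0 a, u₁ r = u₂ r) :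
    Tendsto (radialFlux W₁ W₂) (nhdsWithin a (Set.Ioi a)) (nhds 0) ∧
    Tendsto (fun r => W₂ r - W₁ r) (nhdsWithin a (Set.Ioi a)) (nhds 0) ∧
    Tendsto (radialWronskian u₁ u₂) (nhdsWithin a (Set.Ioi a)) (nhds 0) := by
  rcases ha.eq_or_lt with rfl | ha'
  · exact ⟨h₁.tendsto_radialFlux_zero h₂, h₁.tendsto_W_sub_zero h₂,
      h₁.tendsto_radialWronskian_zero h₂⟩
  · have hfl : radialFlux W₁ W₂ a = 0 := by
      simpa using abs_le_of_hasDerivAt_of_tendsto_zero (K := 0) ha'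
        (fun x hx => h₁.hasDerivAt_radialFlux h₂ hx.1) (h₁.tendsto_radialFlux_zero h₂)
        (fun x hx => by simp [h x hx])
    have hW : W₂ a - W₁ a = 0 := h₁.W_eq_of_u_eq h₂ h ⟨ha', le_rfl⟩
    have hw : radialWronskian u₁ u₂ a = 0 := by
      simpa using abs_le_of_hasDerivAt_of_tendsto_zero (K := 0) ha'
        (fun x hx => h₁.hasDerivAt_radialWronskian h₂ hx.1)
        (h₁.tendsto_radialWronskian_zero h₂)
        (fun x hx => by simp [h₁.W_eq_of_u_eq h₂ h hx])
    refine ⟨?_, ?_, ?_⟩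
    · simpa [hfl] using (h₁.hasDerivAt_radialFlux h₂ ha').continuousAt.tendsto.mono_left
        (nhdsWithin_le_nhds (s := Set.Ioi a))
    · simpa [hW] using (h₁.hasDerivAt_W_sub h₂ ha').continuousAt.tendsto.mono_left
        (nhdsWithin_le_nhds (s := Set.Ioi a))
    · simpa [hw] using (h₁.hasDerivAt_radialWronskian h₂ ha').continuousAt.tendsto.mono_left
        (nhdsWithin_le_nhds (s := Set.Ioi a))

theorem logRatio_eq_zero_iff (h₁ : IsRadialSolution m u₁ W₁) (h₂ : IsRadialSolution m u₂ W₂)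
    {r : ℝ} (hr : 0 < r) : logRatio u₁ u₂ r = 0 ↔ u₁ r = u₂ r := by
  rw [logRatio, sub_eq_zero, eq_comm]
  exact ⟨fun h => Real.log_injOn_pos (h₁.pos r hr) (h₂.pos r hr) h, fun h => by rw [h]⟩

theorem logRatio_pos_iff (h₁ : IsRadialSolution m u₁ W₁) (h₂ : IsRadialSolution m u₂ W₂)
    {r : ℝ} (hr : 0 < r) : 0 < logRatio u₁ u₂ r ↔ u₁ r < u₂ r := by
  rw [logRatio, sub_pos]
  exact Real.log_lt_log_iff (h₁.pos r hr) (h₂.pos r hr)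

theorem exists_bound_u (h : IsRadialSolution m u W) {a b : ℝ} (ha : 0 ≤ a) :
    ∃ B, ∀ r ∈ Set.Icc a b, u r ≤ B := by
  obtain ⟨B, hB⟩ := (isCompact_Icc (a := a) (b := b)).exists_bound_of_continuousOn
    (h.contDiffOn_u.continuousOn.mono fun x hx => ha.trans hx.1)
  exact ⟨B, fun r hr => (le_abs_self _).trans (hB r hr)⟩

/-- Local uniqueness to the right of `a`, including at the singular point `a = 0`. -/
theorem exists_u_eq_of_tendsto_logRatio (h₁ : IsRadialSolution m u₁ W₁)
    (h₂ : IsRadialSolution m u₂ W₂) {a : ℝ} (ha : 0 ≤ a) (h : ∀ r ∈ Set.Ioc 0 a, u₁ r = u₂ r)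
    (hlim : Tendsto (logRatio u₁ u₂) (nhdsWithin a (Set.Ioi a)) (nhds 0)) :
    ∃ b > a, ∀ r ∈ Set.Ioc a b, u₁ r = u₂ r := by
  obtain ⟨hfl, hW, hw⟩ := h₁.tendsto_of_u_eq h₂ ha h
  obtain ⟨b₁, hb₁, hu₁⟩ := h₁.exists_le_two_mul ha
  obtain ⟨b₂, hb₂, hu₂⟩ := h₂.exists_le_two_mul ha
  obtain ⟨B₁, hB₁⟩ := h₁.exists_bound_u (b := a + 1) ha
  obtain ⟨B₂, hB₂⟩ := h₂.exists_bound_u (b := a + 1) ha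
  obtain ⟨b₃, hb₃, hsub⟩ := (mem_nhdsGT_iff_exists_Ioc_subset).1
    (hlim.abs.eventually_lt_const (show |(0 : ℝ)| < 1 by norm_num))
  set B := max B₁ B₂
  obtain ⟨b₄, hb₄, hsub₄⟩ : ∃ b₄ > a, ∀ x ∈ Set.Ioc a b₄, 8 * B ^ 2 * (x - a) ^ 4 < 1 / 2 := by
    have hc : Continuous fun x : ℝ => 8 * B ^ 2 * (x - a) ^ 4 := by fun_prop
    have ht : Tendsto (fun x : ℝ => 8 * B ^ 2 * (x - a) ^ 4) (nhdsWithin a (Set.Ioi a))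
        (nhds 0) := by
      simpa using (hc.tendsto a).mono_left nhdsWithin_le_nhds
    exact (mem_nhdsGT_iff_exists_Ioc_subset).1
      (ht.eventually_lt_const (show (0 : ℝ) < 1 / 2 by norm_num))
  obtain ⟨b, hab, hb⟩ : ∃ b > a, b ≤ b₁ ∧ b ≤ b₂ ∧ b ≤ b₃ ∧ b ≤ b₄ ∧ b ≤ a + 1 := by
    refine ⟨min b₁ (min b₂ (min b₃ (min b₄ (a + 1)))), ?_, ?_⟩
    · simp only [gt_iff_lt, lt_min_iff]
      exact ⟨hb₁, hb₂, hb₃, hb₄, by linarith⟩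
    · simp
  obtain ⟨c₁, c₂, c₃, c₄, c₅⟩ := hb
  have hbound : ∀ n : ℕ, ∀ r ∈ Set.Ioc a b, |logRatio u₁ u₂ r| ≤ (1 / 2) ^ n := by
    intro n
    induction n with
    | zero =>
      intro r hr
      simpa using (hsub ⟨hr.1, hr.2.trans c₃⟩).le
    | succ n ih =>
      have hsq : ∀ r ∈ Set.Ioc a b, |u₂ r ^ 2 - u₁ r ^ 2| ≤ 2 * B ^ 2 * (1 / 2) ^ n := by
        intro r hr
        have hr' : r ∈ Set.Icc a (a + 1) := ⟨hr.1.le, hr.2.trans c₅⟩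
        have := h₁.abs_u_sq_sub_le h₂ (ha.trans_lt hr.1)
          ((hB₁ r hr').trans (le_max_left B₁ B₂)) ((hB₂ r hr').trans (le_max_right B₁ B₂))
        refine this.trans ?_
        have := ih r hr
        gcongr
      intro r hr
      have hder := fun x (hx : x ∈ Set.Ioc a b) => h₁.abs_deriv_logRatio_le h₂ ha
        (fun s r hs hsr hrb => hu₁ s r hs hsr (hrb.trans c₁))
        (fun s r hs hsr hrb => hu₂ s r hs hsr (hrb.trans c₂))
        (fun r hr => h₁.abs_W_sub_le h₂ ha hsq hfl hW hr) hw hx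
      have hl := abs_le_of_hasDerivAt_of_tendsto_zero hr.1
        (fun x hx => h₁.hasDerivAt_logRatio h₂ (ha.trans_lt hx.1)) hlim
        (fun x hx => hder x ⟨hx.1, hx.2.trans hr.2⟩)
      have hba : 0 < b - a := sub_pos.2 hab
      have hrb := hr.2
      calc _ ≤ _ := hl
        _ ≤ 4 * (2 * B ^ 2 * (1 / 2) ^ n * (b - a) ^ 2) * (b - a) * (b - a) := by gcongr
        _ = 8 * B ^ 2 * (b - a) ^ 4 * (1 / 2) ^ n := by ring
        _ ≤ 1 / 2 * (1 / 2) ^ n := by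
          have := (hsub₄ b ⟨hab, c₄⟩).le
          gcongr
        _ = _ := by ring
  refine ⟨b, hab, fun r hr => (h₁.logRatio_eq_zero_iff h₂ (ha.trans_lt hr.1)).1 ?_⟩
  refine abs_eq_zero.1 (le_antisymm ?_ (abs_nonneg _))
  exact ge_of_tendsto' (tendsto_pow_atTop_nhds_zero_of_lt_one (by norm_num) (by norm_num))
    fun n => hbound n r hr

theorem exists_tendsto_logRatio (h₁ : IsRadialSolution m u₁ W₁)
    (h₂ : IsRadialSolution m u₂ W₂) :
    ∃ L, Tendsto (logRatio u₁ u₂) (nhdsWithin 0 (Set.Ioi 0)) (nhds L) := by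
  obtain ⟨b₁, hb₁, hu₁⟩ := h₁.exists_le_two_mul le_rfl
  obtain ⟨b₂, hb₂, hu₂⟩ := h₂.exists_le_two_mul le_rfl
  set b := min b₁ b₂
  have hb : 0 < b := lt_min hb₁ hb₂
  obtain ⟨N, hN⟩ := (isCompact_Icc (a := 0) (b := b)).exists_bound_of_continuousOn
    (f := fun r => W₂ r - W₁ r)
    ((h₂.contDiffOn_W.continuousOn.sub h₁.contDiffOn_W.continuousOn).mono fun x hx => hx.1)
  have hN0 : 0 ≤ N := (norm_nonneg _).trans (hN 0 ⟨le_rfl, hb.le⟩)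
  have hder := fun x (hx : x ∈ Set.Ioc 0 b) => h₁.abs_deriv_logRatio_le h₂ le_rfl
    (fun s r hs hsr hrb => hu₁ s r hs hsr (hrb.trans (min_le_left _ _)))
    (fun s r hs hsr hrb => hu₂ s r hs hsr (hrb.trans (min_le_right _ _)))
    (fun r hr => hN r ⟨hr.1.le, hr.2⟩) (h₁.tendsto_radialWronskian_zero h₂) hx
  have hlip : LipschitzOnWith (4 * N * (b - 0)).toNNReal (logRatio u₁ u₂) (Set.Ioc 0 b) := by
    refine (convex_Ioc 0 b).lipschitzOnWith_of_nnnorm_hasDerivWithin_le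
      (fun x hx => (h₁.hasDerivAt_logRatio h₂ hx.1).hasDerivWithinAt) (fun x hx => ?_)
    rw [← NNReal.coe_le_coe, coe_nnnorm, Real.norm_eq_abs,
      Real.coe_toNNReal _ ((abs_nonneg _).trans (hder x hx))]
    exact hder x hx
  obtain ⟨g, hg, heq⟩ := hlip.extend_real
  refine ⟨g 0, ((hg.continuous.tendsto 0).mono_left nhdsWithin_le_nhds).congr' ?_⟩
  filter_upwards [Ioc_mem_nhdsGT hb] with x hx
  exact (heq hx).symm

theorem radialWronskian_deriv_pos (h₁ : IsRadialSolution m u₁ W₁)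
    (h₂ : IsRadialSolution m u₂ W₂) {c : ℝ} (h : ∀ r ∈ Set.Ioo 0 c, u₁ r < u₂ r)
    {r : ℝ} (hr : r ∈ Set.Ioo 0 c) : 0 < r * (W₂ r - W₁ r) * (u₁ r * u₂ r) := by
  have hfl : ∀ x ∈ Set.Ioo 0 c, 0 < radialFlux W₁ W₂ x := fun x hx =>
    pos_of_hasDerivAt_of_tendsto_zero hx.1 (fun y hy => h₁.hasDerivAt_radialFlux h₂ hy.1)
      (h₁.tendsto_radialFlux_zero h₂) (fun y hy => by
        have := h y ⟨hy.1, hy.2.trans hx.2⟩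
        have := h₁.pos y hy.1
        exact mul_pos hy.1 (by nlinarith))
  have hW : 0 < W₂ r - W₁ r :=
    pos_of_hasDerivAt_of_tendsto_zero (f := fun r => W₂ r - W₁ r) hr.1
      (fun y hy => h₁.hasDerivAt_W_sub h₂ hy.1) (h₁.tendsto_W_sub_zero h₂)
      (fun y hy => div_pos (hfl y ⟨hy.1, hy.2.trans hr.2⟩) hy.1)
  exact mul_pos (mul_pos hr.1 hW) (mul_pos (h₁.pos r hr.1) (h₂.pos r hr.1))

theorem radialWronskian_pos (h₁ : IsRadialSolution m u₁ W₁)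
    (h₂ : IsRadialSolution m u₂ W₂) {c : ℝ} (h : ∀ r ∈ Set.Ioo 0 c, u₁ r < u₂ r)
    {r : ℝ} (hr : r ∈ Set.Ioo 0 c) : 0 < radialWronskian u₁ u₂ r :=
  pos_of_hasDerivAt_of_tendsto_zero hr.1
    (fun _ hy => h₁.hasDerivAt_radialWronskian h₂ hy.1) (h₁.tendsto_radialWronskian_zero h₂)
    (fun _ hy => h₁.radialWronskian_deriv_pos h₂ h ⟨hy.1, hy.2.trans hr.2⟩)

theorem u_lt_of_eventually_lt (h₁ : IsRadialSolution m u₁ W₁)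
    (h₂ : IsRadialSolution m u₂ W₂)
    (h : ∀ᶠ r in nhdsWithin 0 (Set.Ioi 0), u₁ r < u₂ r) {r : ℝ} (hr : 0 < r) :
    u₁ r < u₂ r := by
  obtain ⟨b, hb, hsub⟩ := (mem_nhdsGT_iff_exists_Ioc_subset).1 h
  by_contra! hle
  have hbr : b < r := by
    by_contra! hrb
    exact absurd (hsub ⟨hr, hrb⟩ : u₁ r < u₂ r) hle.not_gt
  have hclosed : IsClosed {x ∈ Set.Icc b r | u₂ x ≤ u₁ x} := by
    have hs : Set.Icc b r ⊆ Set.Ici 0 := fun x hx => (le_of_lt hb).trans hx.1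
    exact isClosed_Icc.isClosed_le (h₂.contDiffOn_u.continuousOn.mono hs)
      (h₁.contDiffOn_u.continuousOn.mono hs)
  obtain ⟨c, ⟨⟨hbc, hcr⟩, hc⟩, hleast⟩ :=
    (isCompact_Icc.of_isClosed_subset hclosed (fun x hx => hx.1)).exists_isLeast
      ⟨r, ⟨hbr.le, le_rfl⟩, hle⟩
  have hc0 : 0 < c := lt_of_lt_of_le hb hbc
  have hlt : ∀ x ∈ Set.Ioo 0 c, u₁ x < u₂ x := by
    intro x hx
    rcases le_or_gt x b with hxb | hxb
    · exact hsub ⟨hx.1, hxb⟩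
    · by_contra! hx'
      exact absurd (hleast ⟨⟨hxb.le, hx.2.le.trans hcr⟩, hx'⟩) hx.2.not_ge
  have hmono := strictMonoOn_Ioc_of_hasDerivAt_pos (a := 0) (r := c)
    (fun x hx => h₁.hasDerivAt_logRatio h₂ hx.1)
    (fun x hx => div_pos (h₁.radialWronskian_pos h₂ hlt hx)
      (mul_pos hx.1 (mul_pos (h₁.pos x hx.1) (h₂.pos x hx.1))))
  have hhalf : c / 2 ∈ Set.Ioo 0 c := ⟨by linarith, by linarith⟩
  have h₃ := (h₁.logRatio_pos_iff h₂ hhalf.1).2 (hlt _ hhalf)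
  have h₄ := hmono ⟨hhalf.1, hhalf.2.le⟩ ⟨hc0, le_rfl⟩ hhalf.2
  exact absurd ((h₁.logRatio_pos_iff h₂ hc0).1 (h₃.trans h₄)) hc.not_gt

theorem tendsto_logRatio_le_zero (h₁ : IsRadialSolution m u₁ W₁)
    (h₂ : IsRadialSolution m u₂ W₂)
    (hw : Tendsto (radialWronskian u₁ u₂) atTop (nhds 0)) {L : ℝ}
    (hL : Tendsto (logRatio u₁ u₂) (nhdsWithin 0 (Set.Ioi 0)) (nhds L)) : L ≤ 0 := by
  by_contra! hpos
  have hev : ∀ᶠ r in nhdsWithin 0 (Set.Ioi 0), u₁ r < u₂ r := by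
    filter_upwards [hL.eventually_const_lt hpos, self_mem_nhdsWithin] with r hr hr0
    exact (h₁.logRatio_pos_iff h₂ hr0).1 hr
  have hlt : ∀ c, ∀ r ∈ Set.Ioo 0 c, u₁ r < u₂ r := fun _ r hr =>
    h₁.u_lt_of_eventually_lt h₂ hev hr.1
  have hw1 : 0 < radialWronskian u₁ u₂ 1 :=
    h₁.radialWronskian_pos h₂ (hlt 2) ⟨by norm_num, by norm_num⟩
  refine absurd (ge_of_tendsto hw ?_) hw1.not_ge
  filter_upwards [eventually_ge_atTop 1] with r hr
  exact (strictMonoOn_Ioc_of_hasDerivAt_pos (a := 0) (r := r)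
    (fun x hx => h₁.hasDerivAt_radialWronskian h₂ hx.1)
    (fun x hx => h₁.radialWronskian_deriv_pos h₂ (hlt r) hx)).monotoneOn
    ⟨by norm_num, hr⟩ ⟨by linarith, le_rfl⟩ hr

theorem u_eq_of_tendsto_logRatio_zero (h₁ : IsRadialSolution m u₁ W₁)
    (h₂ : IsRadialSolution m u₂ W₂)
    (hlim : Tendsto (logRatio u₁ u₂) (nhdsWithin 0 (Set.Ioi 0)) (nhds 0)) {r : ℝ}
    (hr : 0 < r) : u₁ r = u₂ r := by
  obtain ⟨b, hb, heq⟩ := h₁.exists_u_eq_of_tendsto_logRatio h₂ le_rfl (by simp) hlim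
  by_contra hne
  let S : Set ℝ := {x | 0 < x ∧ u₁ x ≠ u₂ x}
  have hbdd : BddBelow S := ⟨0, fun x hx => hx.1.le⟩
  have hS : S.Nonempty := ⟨r, hr, hne⟩
  have hba : b ≤ sInf S := le_csInf hS fun x hx => by
    by_contra! hxb
    exact hx.2 (heq x ⟨hx.1, hxb.le⟩)
  set a := sInf S
  have ha : 0 < a := lt_of_lt_of_le hb hba
  have hlt : ∀ x ∈ Set.Ioo 0 a, logRatio u₁ u₂ x = 0 := by
    intro x hx
    rw [h₁.logRatio_eq_zero_iff h₂ hx.1]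
    by_contra hx'
    exact absurd (csInf_le hbdd (show x ∈ S from ⟨hx.1, hx'⟩)) hx.2.not_ge
  have hca := (h₁.hasDerivAt_logRatio h₂ ha).continuousAt.tendsto
  have hla : logRatio u₁ u₂ a = 0 := by
    refine tendsto_nhds_unique
      (hca.mono_left (nhdsWithin_le_nhds (s := Set.Iio a))) (tendsto_const_nhds.congr' ?_)
    filter_upwards [Ioo_mem_nhdsLT ha] with x hx
    exact (hlt x hx).symm
  have hle : ∀ x ∈ Set.Ioc 0 a, u₁ x = u₂ x := by
    intro x hx
    rw [← h₁.logRatio_eq_zero_iff h₂ hx.1]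
    rcases hx.2.eq_or_lt with rfl | hxa
    · exact hla
    · exact hlt x ⟨hx.1, hxa⟩
  rw [hla] at hca
  obtain ⟨c, hac, hc⟩ := h₁.exists_u_eq_of_tendsto_logRatio h₂ ha.le hle
    (hca.mono_left nhdsWithin_le_nhds)
  obtain ⟨x, hx, hxc⟩ := exists_lt_of_csInf_lt hS hac
  rcases le_or_gt x a with hxa | hxa
  · exact hx.2 (hle x ⟨hx.1, hxa⟩)
  · exact hx.2 (hc x ⟨hxa, hxc.le⟩)

end IsRadialSolution

theorem radial_system_uniqueness (m : ℝ) (hm : 0 ≤ m)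
    (u₁ W₁ u₂ W₂ : ℝ → ℝ)
    (hu₁ : ContDiffOn ℝ 2 u₁ (Set.Ici 0)) (hW₁ : ContDiffOn ℝ 2 W₁ (Set.Ici 0))
    (hu₂ : ContDiffOn ℝ 2 u₂ (Set.Ici 0)) (hW₂ : ContDiffOn ℝ 2 W₂ (Set.Ici 0))
    (hode₁ : ∀ r > (0 : ℝ),
      deriv (deriv u₁) r + deriv u₁ r / r - m ^ 2 / r ^ 2 * u₁ r
        = (W₁ r - 1) * u₁ r)
    (hodeW₁ : ∀ r > (0 : ℝ),
      deriv (deriv W₁) r + deriv W₁ r / r = u₁ r ^ 2)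
    (hode₂ : ∀ r > (0 : ℝ),
      deriv (deriv u₂) r + deriv u₂ r / r - m ^ 2 / r ^ 2 * u₂ r
        = (W₂ r - 1) * u₂ r)
    (hodeW₂ : ∀ r > (0 : ℝ),
      deriv (deriv W₂) r + deriv W₂ r / r = u₂ r ^ 2)
    (hW₁0 : W₁ 0 = 0) (hW₁'0 : deriv W₁ 0 = 0)
    (hW₂0 : W₂ 0 = 0) (hW₂'0 : deriv W₂ 0 = 0)
    (hu₁pos : ∀ r > (0 : ℝ), 0 < u₁ r)
    (hu₂pos : ∀ r > (0 : ℝ), 0 < u₂ r)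
    (hu₁lim : Tendsto u₁ atTop (nhds 0))
    (hu₂lim : Tendsto u₂ atTop (nhds 0))
    (hwronskian : Tendsto
      (fun r => r * (deriv u₂ r * u₁ r - deriv u₁ r * u₂ r)) atTop (nhds 0)) :
    Set.EqOn u₁ u₂ (Set.Ici 0) ∧ Set.EqOn W₁ W₂ (Set.Ici 0) := by
  have h₁ : IsRadialSolution m u₁ W₁ := ⟨hu₁, hW₁, hode₁, hodeW₁, hW₁0, hu₁pos⟩
  have h₂ : IsRadialSolution m u₂ W₂ := ⟨hu₂, hW₂, hode₂, hodeW₂, hW₂0, hu₂pos⟩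
  obtain ⟨L, hL⟩ := h₁.exists_tendsto_logRatio h₂
  have hL₁ : L ≤ 0 := h₁.tendsto_logRatio_le_zero h₂ hwronskian hL
  have hL₂ : -L ≤ 0 := by
    refine h₂.tendsto_logRatio_le_zero h₁ ?_ (hL.neg.congr fun r => ?_)
    · rw [← neg_zero]
      refine hwronskian.neg.congr fun r => ?_
      rw [radialWronskian]
      ring
    · simp only [logRatio, neg_sub]
  obtain rfl : L = 0 := by linarith
  have hu : ∀ r > 0, u₁ r = u₂ r := fun r hr => h₁.u_eq_of_tendsto_logRatio_zero h₂ hL hr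
  refine ⟨fun r hr => ?_, fun r hr => ?_⟩
  · rcases (show (0 : ℝ) ≤ r from hr).eq_or_lt with rfl | hr'
    · refine tendsto_nhds_unique (h₁.tendsto_u le_rfl) ((h₂.tendsto_u le_rfl).congr' ?_)
      filter_upwards [self_mem_nhdsWithin] with x hx
      exact (hu x hx).symm
    · exact hu r hr'
  · rcases (show (0 : ℝ) ≤ r from hr).eq_or_lt with rfl | hr'
    · rw [hW₁0, hW₂0]
    · exact (sub_eq_zero.1
        (h₁.W_eq_of_u_eq h₂ (fun x hx => hu x hx.1) ⟨hr', le_rfl⟩)).symm
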